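/- Let n be a positive integer that is not a prime power and has no prime divisor smaller than 1000. Let r and d be positive integers with d ≥ 16 and r·d ≤ 5.72·log n. Let S be a cyclic extension of ℤ/nℤ of dimension d with generator σ. Then the density of bad witnesses for the product of r Miller–Rabin tests and one Galois test of dimension d, namely #{(x_1,…,x_r,y) ∈ ((ℤ/nℤ)*)^r × S* : every x_i is a Miller–Rabin nonwitness for n and σ(y) = y^n} / ((#(ℤ/nℤ)*)^r · #S*), is at most 2^{−0.18·r·d}. -/

import Mathlib

/-- For `n` odd with `n - 1 = m·2^k`, `m` odd: `x ∈ (ℤ/nℤ)ˣ` is a Miller–Rabin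
nonwitness for `n` if `x^m = 1` or `x^(m·2^i) = -1` for some `0 ≤ i < k`. -/
def MRNonwitness (n m k : ℕ) (x : (ZMod n)ˣ) : Prop :=
  x ^ m = 1 ∨ ∃ i < k, x ^ (m * 2 ^ i) = -1

section

open Finset

/-- The sum of the first `d` translates of `s` under `σ`: the trace, if `σ` has order `d`. -/
def orbitSum {R S : Type*} [CommRing R] [CommRing S] [Algebra R S] (σ : S ≃ₐ[R] S) (d : ℕ)
    (s : S) : S :=
  ∑ i ∈ range d, (σ ^ i) s

/-- In a cyclic Galois extension there are `c y` with `∑ y, c y * σ ^ i y` equal to `1`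
or `0`, according to whether `σ ^ i` is trivial or not. -/
theorem exists_separating {R S : Type*} [CommRing R] [CommRing S] [Fintype S] [Algebra R S]
    (σ : S ≃ₐ[R] S) {d : ℕ} (hd : 0 < d) (hσ : σ ^ d = 1)
    (hunram : ∀ M : Ideal S, M.IsMaximal → ∀ i : ℕ, 0 < i → i < d →
      ∃ x : S, (σ ^ i) x - x ∉ M) :
    ∃ c : S → S, ∀ i, ∑ y, c y * (σ ^ i) y = if d ∣ i then 1 else 0 := by
  let v : S → ℕ → S := fun y i ↦ (σ ^ i) y
  let V : Submodule S (ℕ → S) := Submodule.span S (Set.range v)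
  have hone : (1 : ℕ → S) ∈ V := Submodule.subset_span ⟨1, by ext i; simp [v]⟩
  have hmul : ∀ f ∈ V, ∀ g ∈ V, f * g ∈ V := by
    intro f hf g hg
    have h := Submodule.mul_mem_mul hf hg
    rw [Submodule.span_mul_span] at h
    refine Submodule.span_mono ?_ h
    rintro _ ⟨_, ⟨a, rfl⟩, _, ⟨b, rfl⟩, rfl⟩
    exact ⟨a * b, by ext i; simp [v]⟩
  have hsep : ∀ i, 0 < i → i < d → ∃ f ∈ V, f 0 = 1 ∧ f i = 0 := by
    intro i hi hid
    have htop : Ideal.span (Set.range fun x : S ↦ (σ ^ i) x - x) = ⊤ := by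
      by_contra h
      obtain ⟨M, hM, hle⟩ := Ideal.exists_le_maximal _ h
      obtain ⟨x, hx⟩ := hunram M hM i hi hid
      exact hx (hle (Ideal.subset_span ⟨x, rfl⟩))
    obtain ⟨a, ha⟩ := Ideal.mem_span_range_iff_exists_fun.1
      ((Ideal.eq_top_iff_one _).1 htop)
    refine ⟨∑ x, a x • ((σ ^ i) x • (1 : ℕ → S) - v x), ?_, ?_, ?_⟩
    · exact Submodule.sum_mem _ fun x _ ↦ Submodule.smul_mem _ _
        (Submodule.sub_mem _ (Submodule.smul_mem _ _ hone) (Submodule.subset_span ⟨x, rfl⟩))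
    · simpa [v] using ha
    · simp [v]
  have hprod : ∃ f ∈ V, f 0 = 1 ∧ ∀ i, 0 < i → i < d → f i = 0 := by
    have : ∀ e ≤ d, ∃ f ∈ V, f 0 = 1 ∧ ∀ i, 0 < i → i < e → f i = 0 := by
      intro e
      induction e with
      | zero => exact fun _ ↦ ⟨1, hone, rfl, by simp⟩
      | succ e ih =>
        intro he
        obtain ⟨f, hf, hf0, hfi⟩ := ih (by omega)
        rcases Nat.eq_zero_or_pos e with rfl | hpos
        · exact ⟨f, hf, hf0, by intro i; omega⟩
        obtain ⟨g, hg, hg0, hgi⟩ := hsep e hpos (by omega)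
        refine ⟨f * g, hmul _ hf _ hg, by simp [hf0, hg0], fun i hi hie ↦ ?_⟩
        rcases Nat.lt_succ_iff_lt_or_eq.1 hie with h | rfl
        · simp [hfi i hi h]
        · simp [hgi]
    exact this d le_rfl
  obtain ⟨f, hf, hf0, hfi⟩ := hprod
  obtain ⟨c, hc⟩ := (Submodule.mem_span_range_iff_exists_fun S).1 hf
  refine ⟨c, fun i ↦ ?_⟩
  have hper : (σ ^ i) = σ ^ (i % d) := by
    conv_lhs => rw [← Nat.mod_add_div i d, pow_add, pow_mul, hσ, one_pow, mul_one]
  have hval : ∑ y, c y * (σ ^ (i % d)) y = f (i % d) := by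
    rw [← hc]; simp [v]
  rw [hper, hval]
  split_ifs with h
  · rw [Nat.dvd_iff_mod_eq_zero.1 h, hf0]
  · exact hfi _ (Nat.pos_of_ne_zero fun h' ↦ h (Nat.dvd_of_mod_eq_zero h')) (Nat.mod_lt _ hd)

theorem eq_sum_mul_orbitSum {R S : Type*} [CommRing R] [CommRing S] [Fintype S] [Algebra R S]
    {σ : S ≃ₐ[R] S} {d : ℕ} (hd : 0 < d) {c : S → S}
    (hc : ∀ i, ∑ y, c y * (σ ^ i) y = if d ∣ i then 1 else 0) (s : S) :
    s = ∑ y, c y * orbitSum σ d (y * s) := by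
  simp only [orbitSum, map_mul, mul_sum]
  rw [sum_comm]
  simp only [← mul_assoc, ← sum_mul, hc]
  rw [sum_eq_single_of_mem 0 (by simpa using hd)]
  · simp
  · intro i hi h0
    rw [if_neg fun h ↦ h0 (Nat.eq_zero_of_dvd_of_lt h (mem_range.1 hi)), zero_mul]

theorem map_orbitSum {R S : Type*} [CommRing R] [CommRing S] [Algebra R S]
    {σ : S ≃ₐ[R] S} {d : ℕ} (hσ : σ ^ d = 1) (s : S) :
    σ (orbitSum σ d s) = orbitSum σ d s := by
  have h1 : σ (orbitSum σ d s) = ∑ i ∈ range d, (σ ^ (i + 1)) s := by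
    simp [orbitSum, pow_succ']
  have h2 := sum_range_succ' (fun i ↦ (σ ^ i) s) d
  rw [sum_range_succ, hσ, pow_zero] at h2
  rw [h1, orbitSum]
  exact (add_right_cancel h2).symm

/-- An element all of whose traces `tr (y * s)` lie in an ideal lies in that ideal. -/
theorem mem_of_orbitSum_mem {R S : Type*} [CommRing R] [CommRing S] [Fintype S] [Algebra R S]
    {σ : S ≃ₐ[R] S} {d : ℕ} (hd : 0 < d) {c : S → S}
    (hc : ∀ i, ∑ y, c y * (σ ^ i) y = if d ∣ i then 1 else 0) {J : Ideal S} {s : S}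
    (h : ∀ y, orbitSum σ d (y * s) ∈ J) : s ∈ J := by
  rw [eq_sum_mul_orbitSum hd hc s]
  exact J.sum_mem fun y _ ↦ J.mul_mem_left _ (h y)

section

variable {n d p : ℕ} {S : Type*} [CommRing S] [Algebra (ZMod n) S]
  {σ : S ≃ₐ[ZMod n] S} {c : S → S}

theorem exists_natCast_eq_orbitSum [NeZero n] (hσ : σ ^ d = 1)
    (hfix : ∀ x : S, σ x = x ↔ x ∈ Set.range (algebraMap (ZMod n) S)) (s : S) :
    ∃ j : ℕ, (j : S) = orbitSum σ d s := by
  obtain ⟨a, ha⟩ := (hfix _).1 (map_orbitSum hσ s)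
  exact ⟨a.val, by rw [← ha, ← map_natCast (algebraMap (ZMod n) S), ZMod.natCast_zmod_val]⟩

theorem natCast_eq_zero_iff_dvd (hfaithful : Function.Injective (algebraMap (ZMod n) S)) (j : ℕ) :
    (j : S) = 0 ↔ n ∣ j := by
  rw [← map_natCast (algebraMap (ZMod n) S), map_eq_zero_iff _ hfaithful,
    ZMod.natCast_eq_zero_iff]

/-- If `n = p * q`, then the annihilator of `q` is generated by `p`. -/
theorem mem_span_of_mul_eq_zero [NeZero n] [Fintype S] (hd : 0 < d) (hσ : σ ^ d = 1)
    (hfix : ∀ x : S, σ x = x ↔ x ∈ Set.range (algebraMap (ZMod n) S))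
    (hfaithful : Function.Injective (algebraMap (ZMod n) S))
    (hc : ∀ i, ∑ y, c y * (σ ^ i) y = if d ∣ i then 1 else 0) {q : ℕ} (hpq : n = p * q)
    {s : S} (hs : (q : S) * s = 0) : s ∈ Ideal.span {(p : S)} := by
  refine mem_of_orbitSum_mem hd hc fun y ↦ ?_
  obtain ⟨j, hj⟩ := exists_natCast_eq_orbitSum hσ hfix (y * s)
  have h0 : ((q * j : ℕ) : S) = 0 := by
    have : ∀ i, (q : S) * (σ ^ i) (y * s) = 0 := fun i ↦ by
      rw [← map_natCast (σ ^ i) q, ← map_mul, mul_left_comm, hs, mul_zero, map_zero]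
    rw [Nat.cast_mul, hj, orbitSum, mul_sum, sum_eq_zero fun i _ ↦ this i]
  rw [natCast_eq_zero_iff_dvd hfaithful, hpq, mul_comm] at h0
  have hq : 0 < q := Nat.pos_of_ne_zero fun h ↦ NeZero.ne n (by simp [hpq, h])
  obtain ⟨b, rfl⟩ := Nat.dvd_of_mul_dvd_mul_left hq h0
  rw [← hj, Nat.cast_mul]
  exact Ideal.mul_mem_right _ _ (Ideal.mem_span_singleton_self _)

theorem natCast_mem_span_of_mem (hp : p.Prime) {M : Ideal S} (hM : M ≠ ⊤) (hpM : (p : S) ∈ M)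
    {j : ℕ} (hj : (j : S) ∈ M) : (j : S) ∈ Ideal.span {(p : S)} := by
  by_cases h : p ∣ j
  · exact Ideal.mem_span_singleton.2 (Nat.cast_dvd_cast h)
  · refine absurd ((Ideal.eq_top_iff_one M).2 ?_) hM
    have := congrArg (Int.cast : ℤ → S) (Nat.isCoprime_iff_coprime.2
      ((Nat.Prime.coprime_iff_not_dvd hp).2 h)).choose_spec.choose_spec
    push_cast at this
    rw [← this]
    exact M.add_mem (M.mul_mem_left _ hpM) (M.mul_mem_left _ hj)

/-- The conjugates of a prime over `p` intersect in `(p)`. -/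
theorem mem_span_of_forall_pow_mem [NeZero n] [Fintype S] (hd : 0 < d) (hσ : σ ^ d = 1)
    (hfix : ∀ x : S, σ x = x ↔ x ∈ Set.range (algebraMap (ZMod n) S))
    (hc : ∀ i, ∑ y, c y * (σ ^ i) y = if d ∣ i then 1 else 0)
    (hp : p.Prime) {M : Ideal S} (hM : M ≠ ⊤) (hpM : (p : S) ∈ M)
    {s : S} (hs : ∀ i, (σ ^ i) s ∈ M) : s ∈ Ideal.span {(p : S)} := by
  refine mem_of_orbitSum_mem hd hc fun y ↦ ?_
  obtain ⟨j, hj⟩ := exists_natCast_eq_orbitSum hσ hfix (y * s)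
  rw [← hj]
  refine natCast_mem_span_of_mem hp hM hpM ?_
  rw [hj, orbitSum]
  exact M.sum_mem fun i _ ↦ by rw [map_mul]; exact M.mul_mem_left _ (hs i)

end

/-- A nonzero finite ring of characteristic `p` with `d` independent endomorphisms has at
least `p ^ d` elements. -/
theorem pow_le_card_of_separated {A ι : Type*} [CommRing A] [Nontrivial A] [Finite A] [Fintype ι]
    {p d : ℕ} (hp : p.Prime) (hpA : (p : A) = 0) (τ : Fin d → A →+* A) (c : Fin d → ι → A)
    (y : ι → A) (h : ∀ k i, ∑ j, c k j * τ i (y j) = if i = k then 1 else 0) :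
    p ^ d ≤ Nat.card A := by
  have : Fact p.Prime := ⟨hp⟩
  have : Fintype A := Fintype.ofFinite A
  have hsmul : ∀ x : A, p • x = 0 := fun x ↦ by rw [nsmul_eq_mul, hpA, zero_mul]
  have : Module (ZMod p) A := AddCommGroup.zmodModule hsmul
  have b := Module.finBasis (ZMod p) A
  set ρ := Module.finrank (ZMod p) A
  have hcard : Fintype.card A = p ^ ρ := by
    rw [Module.card_eq_pow_finrank (K := ZMod p), ZMod.card]
  let L : (Fin d → A) → (A →+ A) := fun s ↦
    ∑ i, (AddMonoidHom.mulLeft (s i)).comp (τ i).toAddMonoidHom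
  have hL : ∀ s x, L s x = ∑ i, s i * τ i x := fun s x ↦ by
    simp [L, AddMonoidHom.finsetSum_apply]
  have hinj : Function.Injective fun (s : Fin d → A) (j : Fin ρ) ↦ L s (b j) := by
    intro s t hst
    have hlin : ∀ x, L s x = L t x := fun x ↦
      LinearMap.congr_fun (f := (L s).toZModLinearMap p) (g := (L t).toZModLinearMap p)
        (b.ext fun j ↦ congrFun hst j) x
    have hcoord : ∀ (s : Fin d → A) k, ∑ j, c k j * L s (y j) = s k := by
      intro s k
      simp only [hL, mul_sum]
      rw [sum_comm]
      simp only [mul_left_comm _ (s _), ← mul_sum, h]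
      simp
    funext k
    rw [← hcoord s k, ← hcoord t k]
    simp only [hlin]
  have hle := Fintype.card_le_of_injective _ hinj
  rw [Fintype.card_fun, Fintype.card_fun, Fintype.card_fin, Fintype.card_fin] at hle
  have hdρ : d ≤ ρ := (Nat.pow_le_pow_iff_right Fintype.one_lt_card).1 hle
  rw [Nat.card_eq_fintype_card, hcard]
  exact Nat.pow_le_pow_right hp.pos hdρ

section

variable {n d p : ℕ} {S : Type*} [CommRing S] [Algebra (ZMod n) S]
  {σ : S ≃ₐ[ZMod n] S} {c : S → S}

theorem map_span_natCast (σ : S ≃ₐ[ZMod n] S) (p : ℕ) :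
    Ideal.span {(p : S)} = (Ideal.span {(p : S)}).map (σ : S →+* S) := by
  rw [Ideal.map_span, Set.image_singleton, map_natCast]

/-- The automorphism of `S / p` induced by `σ`. -/
noncomputable def quotAut (σ : S ≃ₐ[ZMod n] S) (p : ℕ) :
    (S ⧸ Ideal.span {(p : S)}) ≃+* (S ⧸ Ideal.span {(p : S)}) :=
  Ideal.quotientEquiv _ _ (σ : S ≃+* S) (map_span_natCast σ p)

theorem quotAut_mk (x : S) :
    quotAut σ p (Ideal.Quotient.mk _ x) = Ideal.Quotient.mk _ (σ x) := rfl

theorem quotAut_pow_mk (i : ℕ) (x : S) :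
    (quotAut σ p ^ i) (Ideal.Quotient.mk _ x) = Ideal.Quotient.mk _ ((σ ^ i) x) := by
  induction i with
  | zero => rfl
  | succ i ih => rw [pow_succ', pow_succ', RingAut.mul_apply, ih, quotAut_mk]; rfl

theorem natCast_quot_eq_zero : ((p : ℕ) : S ⧸ Ideal.span {(p : S)}) = 0 := by
  rw [← map_natCast (Ideal.Quotient.mk _), Ideal.Quotient.eq_zero_iff_mem]
  exact Ideal.mem_span_singleton_self _

theorem nontrivial_quot [NeZero n] (hp : p.Prime) (hpn : p ∣ n)
    (hfaithful : Function.Injective (algebraMap (ZMod n) S)) :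
    Nontrivial (S ⧸ Ideal.span {(p : S)}) := by
  rw [Ideal.Quotient.nontrivial_iff]
  intro h
  obtain ⟨u, hu⟩ := Ideal.mem_span_singleton.1 ((Ideal.eq_top_iff_one _).1 h)
  obtain ⟨q, hq⟩ := hpn
  have hn : n ∣ q := by
    rw [← natCast_eq_zero_iff_dvd hfaithful, ← mul_one (q : S), hu, ← mul_assoc, ← Nat.cast_mul,
      mul_comm q, ← hq, (natCast_eq_zero_iff_dvd hfaithful n).2 dvd_rfl, zero_mul]
  have h0 := NeZero.ne n
  have hq0 : 0 < q := Nat.pos_of_ne_zero fun h ↦ h0 (by simp [hq, h])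
  have := Nat.le_of_dvd hq0 hn
  nlinarith [hp.two_le]

theorem pow_le_card_quot [NeZero n] [Fintype S] (hσ : σ ^ d = 1)
    (hfaithful : Function.Injective (algebraMap (ZMod n) S))
    (hc : ∀ i, ∑ y, c y * (σ ^ i) y = if d ∣ i then 1 else 0) (hp : p.Prime) (hpn : p ∣ n) :
    p ^ d ≤ Nat.card (S ⧸ Ideal.span {(p : S)}) := by
  have := nontrivial_quot (S := S) hp hpn hfaithful
  let mk := Ideal.Quotient.mk (Ideal.span {(p : S)})
  refine pow_le_card_of_separated hp natCast_quot_eq_zero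
    (fun i : Fin d ↦ ((quotAut σ p ^ (i : ℕ) : _ ≃+* _) : _ →+* _))
    (fun k y ↦ mk ((σ ^ (k : ℕ)) (c y))) (fun y : S ↦ mk y) fun k i ↦ ?_
  have hki : ∑ y, (σ ^ (k : ℕ)) (c y) * (σ ^ (i : ℕ)) y = if i = k then 1 else 0 := by
    have h1 := congrArg (σ ^ (k : ℕ)) (hc (i + (d - k)))
    have h2 : ∀ y, (σ ^ (k : ℕ)) ((σ ^ ((i : ℕ) + (d - k))) y) = (σ ^ (i : ℕ)) y := by
      intro y
      rw [← AlgEquiv.mul_apply, ← pow_add, show (k : ℕ) + (i + (d - k)) = i + d by omega,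
        pow_add, hσ, mul_one]
    simp only [map_sum, map_mul, h2] at h1
    rw [h1]
    have h3 : d ∣ (i : ℕ) + (d - k) ↔ i = k := by
      constructor
      · rintro ⟨q, hq⟩
        have hq1 : q = 1 := by
          rcases q with _ | _ | q
          · omega
          · rfl
          · have : d * (q + 1 + 1) = d * q + d + d := by ring
            have : 0 ≤ d * q := Nat.zero_le _
            omega
        subst hq1
        ext; omega
      · rintro rfl
        exact ⟨1, by omega⟩
    simp only [h3]
    split_ifs <;> simp
  have h1 := congrArg mk hki
  simp only [map_sum, map_mul, apply_ite mk, map_one, map_zero] at h1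
  rw [← h1]
  exact sum_congr rfl fun y _ ↦ congrArg _ (quotAut_pow_mk _ _)

/-- If `n = p ^ a * E`, then `p ^ (a - j) * E` generates an ideal with at least
`#(S / p) ^ j` elements. -/
theorem card_quot_pow_le_card_span [NeZero n] [Fintype S] (hd : 0 < d) (hσ : σ ^ d = 1)
    (hfix : ∀ x : S, σ x = x ↔ x ∈ Set.range (algebraMap (ZMod n) S))
    (hfaithful : Function.Injective (algebraMap (ZMod n) S))
    (hc : ∀ i, ∑ y, c y * (σ ^ i) y = if d ∣ i then 1 else 0)
    {a E : ℕ} (hn : n = p ^ a * E) (j : ℕ) (hj : j ≤ a) :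
    Nat.card (S ⧸ Ideal.span {(p : S)}) ^ j
      ≤ Nat.card (Ideal.span {((p ^ (a - j) * E : ℕ) : S)}) := by
  induction j with
  | zero => exact Nat.one_le_iff_ne_zero.2 Nat.card_pos.ne'
  | succ j ih =>
    have hstep : (p ^ (a - j) * E : ℕ) = p * (p ^ (a - (j + 1)) * E) := by
      rw [show a - j = a - (j + 1) + 1 by omega, pow_succ]; ring
    set x : ℕ := p ^ (a - (j + 1)) * E with hx
    rw [hstep] at ih
    rw [pow_succ']
    refine (Nat.mul_le_mul_left _ (ih (by omega))).trans ?_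
    rw [← Nat.card_prod]
    let f : (S ⧸ Ideal.span {(p : S)}) × Ideal.span {((p * x : ℕ) : S)} →
        Ideal.span {(x : S)} := fun w ↦ ⟨x * Quotient.out w.1 + w.2, by
      refine Ideal.add_mem _ (Ideal.mul_mem_right _ _ (Ideal.mem_span_singleton_self _)) ?_
      exact Ideal.span_singleton_le_span_singleton.2 (by simp) w.2.2⟩
    refine Nat.card_le_card_of_injective f fun w w' h ↦ ?_
    have h := congrArg Subtype.val h
    simp only [f] at h
    obtain ⟨z, hz⟩ := Ideal.mem_span_singleton.1 (w.2).2
    obtain ⟨z', hz'⟩ := Ideal.mem_span_singleton.1 (w'.2).2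
    have hzero : ((p ^ j * x : ℕ) : S) * (Quotient.out w.1 - Quotient.out w'.1) = 0 := by
      have h1 : ((p ^ j * (p * x) : ℕ) : S) = 0 := by
        rw [natCast_eq_zero_iff_dvd hfaithful, hn]
        refine dvd_of_eq ?_
        rw [← hstep, ← mul_assoc, ← pow_add, show j + (a - j) = a by omega]
      push_cast at h1 hz hz' ⊢
      rw [hz, hz'] at h
      linear_combination (p : S) ^ j * h + (z' - z) * h1
    have hmem := mem_span_of_mul_eq_zero hd hσ hfix hfaithful hc (p := p) (by
      rw [hn, hx, ← mul_assoc, ← mul_assoc, ← pow_succ', ← pow_add,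
        show j + 1 + (a - (j + 1)) = a by omega]) hzero
    have h1 : w.1 = w'.1 := by
      have := Ideal.Quotient.eq.2 hmem
      rwa [show Ideal.Quotient.mk (Ideal.span {(p : S)}) (Quotient.out w.1) = w.1 from
          Quotient.out_eq _,
        show Ideal.Quotient.mk (Ideal.span {(p : S)}) (Quotient.out w'.1) = w'.1 from
          Quotient.out_eq _] at this
    refine Prod.ext h1 (Subtype.ext ?_)
    rw [h1] at h
    exact add_left_cancel h

end

section

variable {n d p : ℕ} {S : Type*} [CommRing S] [Algebra (ZMod n) S]
  {σ : S ≃ₐ[ZMod n] S} {c : S → S}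

/-- The group of units passing the Galois test. -/
def galoisNonwitnesses (σ : S ≃ₐ[ZMod n] S) : Subgroup Sˣ :=
  (Units.map (σ : S →* S)).eqLocus (powMonoidHom n)

theorem mem_galoisNonwitnesses {y : Sˣ} :
    y ∈ galoisNonwitnesses σ ↔ σ (y : S) = (y : S) ^ n := by
  change Units.map (σ : S →* S) y = y ^ n ↔ _
  rw [Units.ext_iff]
  rfl

theorem pow_apply_of_mem_galoisNonwitnesses {y : Sˣ} (hy : y ∈ galoisNonwitnesses σ) (i : ℕ) :
    (σ ^ i) (y : S) = (y : S) ^ n ^ i := by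
  induction i with
  | zero => simp
  | succ i ih =>
    rw [pow_succ', AlgEquiv.mul_apply, ih, map_pow, mem_galoisNonwitnesses.1 hy, ← pow_mul,
      pow_succ']

theorem pow_mul_cast_eq_zero {a E : ℕ} (hn : n = p ^ a * E) : (p : S) ^ a * E = 0 := by
  have : ((n : ℕ) : S) = 0 := by
    rw [← map_natCast (algebraMap (ZMod n) S), ZMod.natCast_self, map_zero]
  simpa [hn] using this

theorem eq_one_of_mem_galoisNonwitnesses (hd : 0 < d) (hσ : σ ^ d = 1) {a E : ℕ}
    (hn : n = p ^ a * E) (ha : 0 < a) (hE : Nat.Coprime (p ^ a) E)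
    {y : Sˣ} (hy : y ∈ galoisNonwitnesses σ)
    (hyE : (y : S) - 1 ∈ Ideal.span {((p * E : ℕ) : S)}) : y = 1 := by
  have hn0 := pow_mul_cast_eq_zero (S := S) hn
  obtain ⟨u, hu⟩ := Ideal.mem_span_singleton.1 hyE
  push_cast at hu
  have hpow : (y : S) ^ p ^ a = 1 := by
    obtain ⟨v, hv⟩ := dvd_sub_pow_of_dvd_sub (p := p) (a := (y : S)) (b := 1)
      ⟨E * u, by rw [hu]; ring⟩ a
    obtain ⟨w, hw⟩ : (E : S) ∣ (y : S) ^ p ^ a - 1 ^ p ^ a :=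
      (Dvd.intro_left ((p : S) * u) (by rw [hu]; ring)).trans (sub_dvd_pow_sub_pow _ _ _)
    obtain ⟨α, β, hαβ⟩ := Nat.isCoprime_iff_coprime.2 hE
    have hαβ := congrArg (Int.cast : ℤ → S) hαβ
    push_cast at hαβ
    rw [one_pow] at hv hw
    rw [← sub_eq_zero]
    linear_combination (-((y : S) ^ p ^ a - 1)) * hαβ + α * (p : S) ^ a * hw + β * E * hv
      + (α * w + β * p * v) * hn0
  have hfix : (y : S) ^ (n ^ d) = y := by
    rw [← pow_apply_of_mem_galoisNonwitnesses hy, hσ, AlgEquiv.one_apply]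
  have hiter : ∀ j, (y : S) ^ ((n ^ d) ^ j) = y := by
    intro j
    induction j with
    | zero => simp
    | succ j ih => rw [pow_succ, pow_mul, ih, hfix]
  have hdvd : p ^ a ∣ (n ^ d) ^ a := pow_dvd_pow_of_dvd
    ((((dvd_pow_self p ha.ne').trans (Dvd.intro _ hn.symm))).trans (dvd_pow_self n hd.ne')) a
  obtain ⟨q, hq⟩ := hdvd
  ext
  rw [← hiter a, hq, pow_mul, hpow, one_pow, Units.val_one]

theorem exists_units_map_mk_eq {a E : ℕ} (hn : n = p ^ a * E) (ha : 0 < a)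
    (hE : Nat.Coprime (p ^ a) E) (u : (S ⧸ Ideal.span {(p : S)})ˣ) :
    ∃ w : Sˣ, Units.map (Ideal.Quotient.mk (Ideal.span {(p : S)}) : S →* _) w = u := by
  have hn0 := pow_mul_cast_eq_zero (S := S) hn
  obtain ⟨α, β, hαβ⟩ := Nat.isCoprime_iff_coprime.2 hE
  have hαβ := congrArg (Int.cast : ℤ → S) hαβ
  push_cast at hαβ
  obtain ⟨x, hx⟩ := Ideal.Quotient.mk_surjective (u : S ⧸ Ideal.span {(p : S)})
  obtain ⟨y, hy⟩ := Ideal.Quotient.mk_surjective ((u⁻¹ : _ˣ) : S ⧸ Ideal.span {(p : S)})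
  obtain ⟨z, hz⟩ : (p : S) ∣ x * y - 1 := by
    rw [← Ideal.mem_span_singleton, ← Ideal.Quotient.eq, map_mul, hx, hy, Units.mul_inv, map_one]
  obtain ⟨e, he⟩ : ∃ e : S, e = β * E := ⟨_, rfl⟩
  rw [← he] at hαβ
  have hee : e * e = e := by
    linear_combination e * hαβ - β * α * hn0 - α * p ^ a * he
  have hnil : IsNilpotent (e * (p * z)) := by
    refine ⟨a, ?_⟩
    obtain ⟨b, rfl⟩ := Nat.exists_eq_add_of_le' ha
    have : e * (p : S) ^ (b + 1) = 0 := by linear_combination β * hn0 + p ^ (b + 1) * he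
    rw [mul_pow, mul_pow, pow_succ e]
    linear_combination (e ^ b * z ^ (b + 1)) * this
  have hunit : IsUnit (e * x + (1 - e)) := by
    refine isUnit_of_mul_isUnit_left (y := e * y + (1 - e)) ?_
    convert hnil.isUnit_one_add using 1
    linear_combination (x * y - x - y + 1) * hee + e * hz
  refine ⟨hunit.unit, Units.ext ?_⟩
  change Ideal.Quotient.mk _ (e * x + (1 - e)) = _
  rw [← hx, Ideal.Quotient.eq, Ideal.mem_span_singleton]
  have : (p : S) ∣ 1 - e := by
    refine (dvd_pow_self (p : S) ha.ne').trans ⟨α, ?_⟩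
    linear_combination -hαβ
  obtain ⟨w, hw⟩ := this
  exact ⟨w * (1 - x), by linear_combination (1 - x) * hw⟩

theorem card_galoisNonwitnesses_mul_le [Finite S] (hd : 0 < d) (hσ : σ ^ d = 1) {a E : ℕ}
    (hn : n = p ^ a * E) (ha : 0 < a) (hE : Nat.Coprime (p ^ a) E) :
    Nat.card (galoisNonwitnesses σ) * Nat.card (Ideal.span {((p * E : ℕ) : S)})
        * Nat.card (S ⧸ Ideal.span {(p : S)})ˣ
      ≤ Nat.card Sˣ * Nat.card ((galoisNonwitnesses σ).map
        (Units.map (Ideal.Quotient.mk (Ideal.span {(p : S)}) : S →* S ⧸ Ideal.span {(p : S)}))) := by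
  set π : Sˣ →* (S ⧸ Ideal.span {(p : S)})ˣ :=
    Units.map (Ideal.Quotient.mk (Ideal.span {(p : S)}) : S →* _)
  have hn0 := pow_mul_cast_eq_zero (S := S) hn
  have hsurj : ∀ u, ∃ w, π w = u := exists_units_map_mk_eq hn ha hE
  choose w hw using hsurj
  have hone : ∀ z : Ideal.span {((p * E : ℕ) : S)}, ∃ v : Sˣ, (v : S) = 1 + z := by
    intro z
    obtain ⟨u, hu⟩ := Ideal.mem_span_singleton.1 z.2
    push_cast at hu
    have hnil : IsNilpotent (z : S) := by
      refine ⟨a, ?_⟩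
      obtain ⟨b, rfl⟩ := Nat.exists_eq_add_of_le' ha
      rw [hu, mul_pow, mul_pow, pow_succ (E : S)]
      linear_combination (E ^ b * u ^ (b + 1)) * hn0
    exact ⟨hnil.isUnit_one_add.unit, rfl⟩
  choose v hv using hone
  have hπv : ∀ z, π (v z) = 1 := by
    intro z
    ext
    change Ideal.Quotient.mk _ (v z : S) = 1
    rw [hv, map_add, map_one, add_eq_left, Ideal.Quotient.eq_zero_iff_mem]
    exact Ideal.span_singleton_le_span_singleton.2 (by simp) z.2
  rw [← Nat.card_prod, ← Nat.card_prod, ← Nat.card_prod]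
  let f : (galoisNonwitnesses σ × Ideal.span {((p * E : ℕ) : S)}) × (S ⧸ Ideal.span {(p : S)})ˣ →
      Sˣ × (galoisNonwitnesses σ).map π := fun t ↦
    (t.1.1 * v t.1.2 * w ((π t.1.1)⁻¹ * t.2), ⟨π t.1.1, Subgroup.mem_map_of_mem _ t.1.1.2⟩)
  have : Finite (S ⧸ Ideal.span {(p : S)}) :=
    Finite.of_surjective _ Ideal.Quotient.mk_surjective
  refine Nat.card_le_card_of_injective f ?_
  rintro ⟨⟨⟨g, hg⟩, z⟩, u⟩ ⟨⟨⟨g', hg'⟩, z'⟩, u'⟩ h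
  simp only [f, Prod.mk.injEq, Subtype.mk.injEq] at h
  obtain ⟨h1, h2⟩ := h
  have h3 := congrArg π h1
  simp only [map_mul, hπv, hw, mul_one, mul_inv_cancel_left] at h3
  subst h3
  rw [h2] at h1
  have h4 : g * v z = g' * v z' := mul_right_cancel h1
  have h5 : g'⁻¹ * g = 1 := by
    refine eq_one_of_mem_galoisNonwitnesses hd hσ hn ha hE (mul_mem (inv_mem hg') hg) ?_
    have h6 : g'⁻¹ * g * v z = v z' := by rw [mul_assoc, h4, inv_mul_cancel_left]
    have h7 := congrArg Units.val h6
    rw [Units.val_mul, hv, hv] at h7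
    have : ((g'⁻¹ * g : Sˣ) : S) - 1 = z' - ((g'⁻¹ * g : Sˣ) : S) * z := by
      linear_combination h7
    rw [this]
    exact Ideal.sub_mem _ z'.2 (Ideal.mul_mem_left _ _ z.2)
  have h8 : g = g' := (inv_mul_eq_one.1 h5).symm
  subst h8
  have h9 := congrArg Units.val (mul_left_cancel h4)
  rw [hv, hv] at h9
  have h10 : z = z' := Subtype.ext (add_left_cancel h9)
  rw [h10]

end

theorem card_le_of_forall_pow_eq_one {k : Type*} [Field k] [Finite k] (H : Subgroup kˣ) {N : ℕ}
    (hN : 0 < N) (h : ∀ y ∈ H, y ^ N = 1) : Nat.card H ≤ N := by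
  rw [← IsCyclic.exponent_eq_card]
  exact Nat.le_of_dvd hN (Monoid.exponent_dvd_of_forall_pow_eq_one fun y ↦ Subtype.ext (h y y.2))

theorem exists_forall_eq_pow {k : Type*} [Field k] [Finite k] {p : ℕ} (hp : p.Prime)
    (hpk : (p : k) = 0) (τ : k ≃+* k) :
    ∃ v ρ : ℕ, v < ρ ∧ Nat.card k = p ^ ρ ∧ ∀ x, τ x = x ^ p ^ v := by
  have : Fact p.Prime := ⟨hp⟩
  have : CharP k p := (CharP.charP_iff_prime_eq_zero hp).2 hpk
  let : Algebra (ZMod p) k := ZMod.algebra k p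
  let τ' : k ≃ₐ[ZMod p] k := AlgEquiv.ofRingEquiv (f := τ) fun r ↦ by
    exact RingHom.congr_fun (Subsingleton.elim ((τ : k →+* k).comp (algebraMap (ZMod p) k))
      (algebraMap (ZMod p) k)) r
  obtain ⟨v, hv⟩ := (FiniteField.bijective_frobeniusAlgEquivOfAlgebraic_pow (ZMod p) k).2 τ'
  refine ⟨v, Module.finrank (ZMod p) k, v.2, ?_, fun x ↦ ?_⟩
  · rw [Module.natCard_eq_pow_finrank (K := ZMod p), Nat.card_zmod]
  · have h1 : τ x = τ' x := rfl
    rw [h1, ← hv]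
    change (FiniteField.frobeniusAlgEquivOfAlgebraic (ZMod p) k ^ (v : ℕ)) x = _
    rw [AlgEquiv.coe_pow, FiniteField.coe_frobeniusAlgEquivOfAlgebraic_iterate, ZMod.card]

theorem card_sq_le_mul_card_of_field {k : Type*} [Field k] [Finite k] {p n : ℕ} (hp : p.Prime)
    (hpk : (p : k) = 0) (τ : k ≃+* k) (H : Subgroup kˣ) (hn0 : 0 < n) (hn : ∀ v, n ≠ p ^ v)
    (hH : ∀ y ∈ H, τ (y : k) = (y : k) ^ n) : Nat.card H ^ 2 ≤ n * Nat.card k := by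
  obtain ⟨v, ρ, hv, hcard, hτ⟩ := exists_forall_eq_pow hp hpk τ
  have hpow : ∀ y ∈ H, y ^ n = y ^ p ^ v := fun y hy ↦ by
    ext
    rw [Units.val_pow_eq_pow_val, Units.val_pow_eq_pow_val, ← hH y hy, hτ]
  rcases lt_or_gt_of_ne (hn v) with h | h
  · have h1 : Nat.card H ≤ p ^ v := by
      refine (card_le_of_forall_pow_eq_one H (Nat.sub_pos_of_lt h) fun y hy ↦ ?_).trans
        (Nat.sub_le _ _)
      rw [pow_sub _ h.le, hpow y hy, mul_inv_cancel]
    have h2 : 1 < n * p ^ (ρ - v) := by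
      have : 1 < p ^ (ρ - v) := Nat.one_lt_pow (by omega) hp.one_lt
      nlinarith
    have h3 : Nat.card H ≤ n * p ^ (ρ - v) := by
      refine (card_le_of_forall_pow_eq_one H (Nat.sub_pos_of_lt h2) fun y hy ↦ ?_).trans
        (Nat.sub_le _ 1)
      have hy' : y ^ p ^ ρ = y := by
        ext
        have : Fintype k := Fintype.ofFinite k
        rw [Units.val_pow_eq_pow_val, ← hcard, Nat.card_eq_fintype_card, FiniteField.pow_card]
      rw [pow_sub _ h2.le, pow_mul, hpow y hy, ← pow_mul, ← pow_add,
        show v + (ρ - v) = ρ by omega, hy', pow_one, mul_inv_cancel]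
    calc Nat.card H ^ 2 ≤ p ^ v * (n * p ^ (ρ - v)) := by rw [sq]; exact Nat.mul_le_mul h1 h3
      _ = n * p ^ (v + (ρ - v)) := by rw [pow_add]; ring
      _ = n * Nat.card k := by rw [hcard, show v + (ρ - v) = ρ by omega]
  · have h1 : Nat.card H ≤ n := by
      refine (card_le_of_forall_pow_eq_one H (Nat.sub_pos_of_lt h) fun y hy ↦ ?_).trans
        (Nat.sub_le _ _)
      rw [pow_sub _ h.le, hpow y hy, mul_inv_cancel]
    have h2 : Nat.card H ≤ Nat.card k :=
      (Nat.card_le_card_of_injective _ Subtype.val_injective).trans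
        (Nat.card_le_card_of_injective _ Units.val_injective)
    rw [sq]
    exact Nat.mul_le_mul h1 h2

section

variable {A : Type*} [CommRing A] [Finite A] {p n : ℕ}

theorem card_eq_prod_card_quot [IsReduced A] [Fintype (MaximalSpectrum A)] :
    Nat.card A = ∏ I : MaximalSpectrum A, Nat.card (A ⧸ I.asIdeal) := by
  rw [Nat.card_congr (IsArtinianRing.equivPi A).toEquiv, Nat.card_pi]

theorem card_units_eq_prod [IsReduced A] [Fintype (MaximalSpectrum A)] :
    Nat.card Aˣ = ∏ I : MaximalSpectrum A, (Nat.card (A ⧸ I.asIdeal) - 1) := by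
  rw [Nat.card_congr (Units.mapEquiv (IsArtinianRing.equivPi A).toMulEquiv).toEquiv,
    Nat.card_congr MulEquiv.piUnits.toEquiv, Nat.card_pi]
  refine prod_congr rfl fun I _ ↦ ?_
  let := Ideal.Quotient.field I.asIdeal
  exact Nat.card_units _

theorem le_card_quot_maximal (hp : p.Prime) (hpA : (p : A) = 0) (M : Ideal A) (hM : M.IsMaximal) :
    p ≤ Nat.card (A ⧸ M) := by
  let := Ideal.Quotient.field M
  have : Finite (A ⧸ M) := Finite.of_surjective _ Ideal.Quotient.mk_surjective
  have h0 : (p : A ⧸ M) = 0 := by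
    rw [← map_natCast (Ideal.Quotient.mk M), hpA, map_zero]
  obtain ⟨v, ρ, hv, hcard, -⟩ := exists_forall_eq_pow hp h0 (RingEquiv.refl (A ⧸ M))
  rw [hcard]
  exact Nat.le_self_pow (by omega) p

theorem pow_le_sub_one_pow {x : ℕ} (hx : 1000 ≤ x) : x ^ 9 ≤ (x - 1) ^ 10 := by
  obtain ⟨y, rfl⟩ := Nat.exists_eq_add_of_le hx
  rw [show 1000 + y - 1 = 999 + y by omega]
  have hr : ∀ z : ℝ, 0 ≤ z → (1000 + z) ^ 9 ≤ (999 + z) ^ 10 := fun z hz ↦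
    calc (1000 + z) ^ 9 ≤ ((1000 / 999) * (999 + z)) ^ 9 := by gcongr; linarith
      _ = (1000 / 999) ^ 9 * (999 + z) ^ 9 := by ring
      _ ≤ (999 + z) * (999 + z) ^ 9 := by gcongr; norm_num; linarith
      _ = (999 + z) ^ 10 := by ring
  exact_mod_cast hr y y.cast_nonneg

theorem card_pow_le_card_units_pow [IsReduced A] (hp : p.Prime) (hp' : 1000 ≤ p) (hpA : (p : A) = 0) :
    Nat.card A ^ 9 ≤ Nat.card Aˣ ^ 10 := by
  have : Fintype (MaximalSpectrum A) := Fintype.ofFinite _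
  rw [card_eq_prod_card_quot, card_units_eq_prod, ← prod_pow, ← prod_pow]
  exact prod_le_prod' fun I _ ↦ pow_le_sub_one_pow
    (hp'.trans (le_card_quot_maximal hp hpA I.asIdeal I.isMaximal))

theorem card_sq_le_mul_card [Nontrivial A] [IsReduced A] (hp : p.Prime) (hpA : (p : A) = 0) (τ : A ≃+* A)
    (H : Subgroup Aˣ) (hn0 : 0 < n) (hn : ∀ v, n ≠ p ^ v)
    (hH : ∀ y ∈ H, τ (y : A) = (y : A) ^ n)
    (hinj : ∀ M : Ideal A, M.IsMaximal → ∀ y ∈ H, (y : A) - 1 ∈ M → y = 1) :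
    Nat.card H ^ 2 ≤ n * Nat.card A := by
  have : Fintype (MaximalSpectrum A) := Fintype.ofFinite _
  rcases subsingleton_or_nontrivial (MaximalSpectrum A) with h | h
  · have : IsLocalRing A := by
      obtain ⟨M, hM⟩ := Ideal.exists_maximal A
      refine IsLocalRing.of_unique_max_ideal ⟨M, hM, fun M' hM' ↦ ?_⟩
      exact congrArg MaximalSpectrum.asIdeal (Subsingleton.elim
        (⟨M', hM'⟩ : MaximalSpectrum A) ⟨M, hM⟩)
    let : Field A := (IsArtinianRing.isField_of_isReduced_of_isLocalRing A).toField
    exact card_sq_le_mul_card_of_field hp hpA τ H hn0 hn hH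
  · have hle : ∀ I : MaximalSpectrum A, Nat.card H ≤ Nat.card (A ⧸ I.asIdeal) - 1 := by
      intro I
      have := I.isMaximal
      let := Ideal.Quotient.field I.asIdeal
      have : Finite (A ⧸ I.asIdeal) := Finite.of_surjective _ Ideal.Quotient.mk_surjective
      rw [← Nat.card_units]
      let f : H →* (A ⧸ I.asIdeal)ˣ :=
        (Units.map (Ideal.Quotient.mk I.asIdeal : A →* A ⧸ I.asIdeal)).comp H.subtype
      refine Nat.card_le_card_of_injective f ((injective_iff_map_eq_one f).2 fun y hy ↦ ?_)
      refine Subtype.ext (hinj I.asIdeal I.isMaximal y y.2 ?_)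
      rw [← Ideal.Quotient.eq, map_one]
      exact congrArg Units.val hy
    have h1 : Nat.card H ^ Fintype.card (MaximalSpectrum A) ≤ Nat.card Aˣ := by
      rw [card_units_eq_prod]
      exact pow_card_le_prod _ _ _ fun I _ ↦ hle I
    calc Nat.card H ^ 2 ≤ Nat.card H ^ Fintype.card (MaximalSpectrum A) :=
          Nat.pow_le_pow_right Nat.card_pos Fintype.one_lt_card
      _ ≤ Nat.card Aˣ := h1
      _ ≤ Nat.card A := Nat.card_le_card_of_injective _ Units.val_injective
      _ ≤ n * Nat.card A := Nat.le_mul_of_pos_left _ hn0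

end

section

variable {n d p : ℕ} {S : Type*} [CommRing S] [Fintype S] [Algebra (ZMod n) S]
  {σ : S ≃ₐ[ZMod n] S} {c : S → S}

theorem isReduced_quot [NeZero n] (hd : 0 < d) (hσ : σ ^ d = 1)
    (hfix : ∀ x : S, σ x = x ↔ x ∈ Set.range (algebraMap (ZMod n) S))
    (hfaithful : Function.Injective (algebraMap (ZMod n) S))
    (hc : ∀ i, ∑ y, c y * (σ ^ i) y = if d ∣ i then 1 else 0) (hp : p.Prime) (hpn : p ∣ n) :
    IsReduced (S ⧸ Ideal.span {(p : S)}) := by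
  have hne := (Ideal.Quotient.nontrivial_iff.1 (nontrivial_quot (S := S) hp hpn hfaithful))
  obtain ⟨M, hM, hle⟩ := Ideal.exists_le_maximal _ hne
  refine ⟨fun x hx ↦ ?_⟩
  obtain ⟨x, rfl⟩ := Ideal.Quotient.mk_surjective x
  obtain ⟨N, hN⟩ := hx
  rw [← map_pow, Ideal.Quotient.eq_zero_iff_mem] at hN
  rw [Ideal.Quotient.eq_zero_iff_mem]
  refine mem_span_of_forall_pow_mem hd hσ hfix hc hp hM.ne_top
    (hle (Ideal.mem_span_singleton_self _)) fun i ↦ hM.isPrime.mem_of_pow_mem N ?_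
  obtain ⟨z, hz⟩ := Ideal.mem_span_singleton.1 hN
  rw [← map_pow, hz, map_mul, map_natCast]
  exact M.mul_mem_right _ (hle (Ideal.mem_span_singleton_self _))

theorem eq_one_of_mem_map_galoisNonwitnesses [NeZero n] (hd : 0 < d) (hσ : σ ^ d = 1)
    (hfix : ∀ x : S, σ x = x ↔ x ∈ Set.range (algebraMap (ZMod n) S))
    (hc : ∀ i, ∑ y, c y * (σ ^ i) y = if d ∣ i then 1 else 0) (hp : p.Prime)
    {M : Ideal (S ⧸ Ideal.span {(p : S)})} (hM : M.IsMaximal) {y : (S ⧸ Ideal.span {(p : S)})ˣ}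
    (hy : y ∈ (galoisNonwitnesses σ).map
      (Units.map (Ideal.Quotient.mk (Ideal.span {(p : S)}) : S →* S ⧸ Ideal.span {(p : S)})))
    (hyM : (y : S ⧸ Ideal.span {(p : S)}) - 1 ∈ M) : y = 1 := by
  obtain ⟨g, hg, rfl⟩ := hy
  set mk := Ideal.Quotient.mk (Ideal.span {(p : S)})
  have hgM : (g : S) - 1 ∈ M.comap mk := by
    rw [Ideal.mem_comap, map_sub, map_one]
    exact hyM
  have hmem : (g : S) - 1 ∈ Ideal.span {(p : S)} := by
    refine mem_span_of_forall_pow_mem hd hσ hfix hc hp (M := M.comap mk)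
      (Ideal.comap_ne_top _ hM.ne_top) ?_ fun i ↦ ?_
    · rw [Ideal.mem_comap, map_natCast, natCast_quot_eq_zero]
      exact M.zero_mem
    · rw [map_sub, map_one, pow_apply_of_mem_galoisNonwitnesses hg]
      exact Ideal.mem_of_dvd _ (sub_one_dvd_pow_sub_one _ _) hgM
  ext
  rw [← Ideal.Quotient.eq, map_one] at hmem
  exact hmem

/-- The Galois test at a prime power `p ^ a` exactly dividing `n`. -/
theorem card_galoisNonwitnesses_pow_le [NeZero n] (hnpp : ∀ v, n ≠ p ^ v)
    (hd : 0 < d) (hσ : σ ^ d = 1)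
    (hfix : ∀ x : S, σ x = x ↔ x ∈ Set.range (algebraMap (ZMod n) S))
    (hfaithful : Function.Injective (algebraMap (ZMod n) S))
    (hunram : ∀ M : Ideal S, M.IsMaximal → ∀ i : ℕ, 0 < i → i < d →
      ∃ x : S, (σ ^ i) x - x ∉ M) (hp : p.Prime) (hp' : 1000 ≤ p) {a E : ℕ}
    (hn : n = p ^ a * E) (ha : 0 < a) (hE : Nat.Coprime (p ^ a) E) :
    Nat.card (galoisNonwitnesses σ) ^ 10 * (p ^ a) ^ (4 * d) ≤ Nat.card Sˣ ^ 10 * n ^ 5 := by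
  obtain ⟨c, hc⟩ := exists_separating σ hd hσ hunram
  have hpn : p ∣ n := (dvd_pow_self p ha.ne').trans (Dvd.intro _ hn.symm)
  have := nontrivial_quot (S := S) hp hpn hfaithful
  have := isReduced_quot hd hσ hfix hfaithful hc hp hpn
  have h1 := card_galoisNonwitnesses_mul_le hd hσ hn ha hE
  have h2 := card_quot_pow_le_card_span hd hσ hfix hfaithful hc hn (a - 1) (Nat.sub_le _ _)
  have h3 : Nat.card (S ⧸ Ideal.span {(p : S)}) ^ 9 ≤ _ :=
    card_pow_le_card_units_pow hp hp' natCast_quot_eq_zero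
  have h4 := card_sq_le_mul_card hp natCast_quot_eq_zero (quotAut σ p)
    ((galoisNonwitnesses σ).map
      (Units.map (Ideal.Quotient.mk (Ideal.span {(p : S)}) : S →* S ⧸ Ideal.span {(p : S)})))
    (NeZero.pos n) hnpp
    (by
      rintro _ ⟨g, hg, rfl⟩
      change quotAut σ p (Ideal.Quotient.mk _ (g : S)) = (Ideal.Quotient.mk _ (g : S)) ^ n
      rw [quotAut_mk, mem_galoisNonwitnesses.1 hg, map_pow])
    (fun M hM y hy hyM ↦ eq_one_of_mem_map_galoisNonwitnesses hd hσ hfix hc hp hM hy hyM)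
  have h5 := pow_le_card_quot hσ hfaithful hc hp hpn
  rw [show a - (a - 1) = 1 by omega, pow_one] at h2
  generalize Nat.card (S ⧸ Ideal.span {(p : S)})ˣ = U at *
  generalize Nat.card (Ideal.span {((p * E : ℕ) : S)}) = K at *
  generalize Nat.card ((galoisNonwitnesses σ).map
    (Units.map (Ideal.Quotient.mk (Ideal.span {(p : S)}) : S →* S ⧸ Ideal.span {(p : S)}))) = h
    at *
  generalize Nat.card (galoisNonwitnesses σ) = g at *
  generalize Nat.card Sˣ = s at *
  generalize Nat.card (S ⧸ Ideal.span {(p : S)}) = X at *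
  have hX : 0 < X := (pow_pos hp.pos d).trans_le h5
  have h6 : g ^ 10 * X ^ (10 * a - 6) * X ^ 5 ≤ s ^ 10 * n ^ 5 * X ^ 5 :=
    calc g ^ 10 * X ^ (10 * a - 6) * X ^ 5 = g ^ 10 * (X ^ (a - 1)) ^ 10 * X ^ 9 := by
          rw [← pow_mul, mul_assoc, mul_assoc, ← pow_add, ← pow_add,
            show 10 * a - 6 + 5 = (a - 1) * 10 + 9 by omega]
      _ ≤ g ^ 10 * K ^ 10 * U ^ 10 := by gcongr
      _ = (g * K * U) ^ 10 := by ring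
      _ ≤ (s * h) ^ 10 := by gcongr
      _ = s ^ 10 * (h ^ 2) ^ 5 := by ring
      _ ≤ s ^ 10 * (n * X) ^ 5 := by gcongr
      _ = s ^ 10 * n ^ 5 * X ^ 5 := by ring
  calc g ^ 10 * (p ^ a) ^ (4 * d) = g ^ 10 * (p ^ d) ^ (4 * a) := by
        rw [← pow_mul, ← pow_mul, show a * (4 * d) = d * (4 * a) by ring]
    _ ≤ g ^ 10 * X ^ (4 * a) := by gcongr
    _ ≤ g ^ 10 * X ^ (10 * a - 6) := by gcongr; omega
    _ ≤ s ^ 10 * n ^ 5 := Nat.le_of_mul_le_mul_right h6 (pow_pos hX 5)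

end

/-- If `-1` is an `e`-th power modulo the odd number `n`, then there are at least `2 ^ ω(n)`
many `e`-th powers modulo `n`. -/
theorem two_pow_le_card_range_pow {n : ℕ} (hn : n ≠ 0) (hodd : Odd n) {e : ℕ} {x : (ZMod n)ˣ}
    (hx : x ^ e = -1) :
    2 ^ n.primeFactors.card ≤ Nat.card (powMonoidHom e : (ZMod n)ˣ →* (ZMod n)ˣ).range := by
  have : NeZero n := ⟨hn⟩
  let Φ : (ZMod n)ˣ ≃* ∀ p : n.primeFactors, (ZMod ((p : ℕ) ^ n.factorization p))ˣ :=
    (Units.mapEquiv (ZMod.equivPi n hn).toMulEquiv).trans MulEquiv.piUnits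
  have hΦ : ∀ p, Φ (-1) p = -1 := fun p ↦ by
    ext
    change (ZMod.equivPi n hn) (-1) p = -1
    simp
  let f : (n.primeFactors → Bool) → (powMonoidHom e : (ZMod n)ˣ →* (ZMod n)ˣ).range := fun ε ↦
    ⟨Φ.symm (fun p ↦ if ε p then Φ x p else 1) ^ e, _, rfl⟩
  have hf : Function.Injective f := by
    intro ε δ h
    have h1 := congrArg (fun y ↦ Φ (Subtype.val y)) h
    simp only [f, map_pow, MulEquiv.apply_symm_apply] at h1
    funext p
    have h2 := congrFun h1 p
    have hxe : (Φ x p) ^ e = -1 := by rw [← hΦ p, ← hx, map_pow, Pi.pow_apply]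
    have hne : (-1 : (ZMod ((p : ℕ) ^ n.factorization p))ˣ) ≠ 1 := by
      have hp := Nat.prime_of_mem_primeFactors p.2
      have hpd := Nat.dvd_of_mem_primeFactors p.2
      have hp2 : (p : ℕ) ≠ 2 := fun h ↦ by
        rw [h] at hpd
        exact (Nat.not_even_iff_odd.2 hodd) (even_iff_two_dvd.2 hpd)
      have h3 : 2 < (p : ℕ) ^ n.factorization p :=
        (lt_of_le_of_ne hp.two_le hp2.symm).trans_le
          (Nat.le_self_pow (hp.factorization_pos_of_dvd hn hpd).ne' _)
      have : Fact (2 < (p : ℕ) ^ n.factorization p) := ⟨h3⟩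
      intro h
      exact ZMod.neg_one_ne_one (by simpa using congrArg Units.val h)
    rw [Pi.pow_apply, Pi.pow_apply] at h2
    cases h3 : ε p <;> cases h4 : δ p <;> simp [h3, h4, hxe, hne, hne.symm] at h2 ⊢
  calc 2 ^ n.primeFactors.card = Nat.card (n.primeFactors → Bool) := by
        rw [Nat.card_eq_fintype_card, Fintype.card_fun, Fintype.card_bool, Fintype.card_coe]
    _ ≤ _ := Nat.card_le_card_of_injective f hf

theorem card_mrNonwitness_mul_le {n m k : ℕ} (hn : 1 < n) (hodd : Odd n) (hm : Odd m)
    (hmk : n - 1 = m * 2 ^ k) :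
    Nat.card {x : (ZMod n)ˣ // MRNonwitness n m k x} * 2 ^ n.primeFactors.card
      ≤ 2 * Nat.card (ZMod n)ˣ := by
  classical
  have : NeZero n := ⟨by omega⟩
  have hk : 0 < k := by
    rcases Nat.eq_zero_or_pos k with rfl | h
    · obtain ⟨a, ha⟩ := hodd
      obtain ⟨b, hb⟩ := hm
      omega
    · exact h
  let P : ℕ → Prop := fun i ↦ i < k ∧ ∃ x : (ZMod n)ˣ, x ^ (m * 2 ^ i) = -1
  have hP0 : P 0 := ⟨hk, -1, by simpa using hm.neg_one_pow⟩
  obtain ⟨j, ⟨hjk, x₀, hx₀⟩, hmax⟩ : ∃ j, P j ∧ ∀ i, P i → i ≤ j := by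
    refine ⟨Nat.findGreatest P k, Nat.findGreatest_spec (P := P) (Nat.zero_le _) hP0,
      fun i hi ↦ Nat.le_findGreatest hi.1.le hi⟩
  set f : (ZMod n)ˣ →* (ZMod n)ˣ := powMonoidHom (m * 2 ^ j) with hf
  have hval : ∀ x, MRNonwitness n m k x → f x = 1 ∨ f x = -1 := by
    rintro x (h | ⟨i, hi, h⟩)
    · left
      rw [hf, powMonoidHom_apply, pow_mul, h, one_pow]
    · have hij : i ≤ j := hmax i ⟨hi, x, h⟩
      rw [hf, powMonoidHom_apply, show m * 2 ^ j = m * 2 ^ i * 2 ^ (j - i) by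
        rw [mul_assoc, ← pow_add, show i + (j - i) = j by omega], pow_mul, h]
      exact neg_one_pow_eq_or _ _
  have hle : Nat.card {x : (ZMod n)ˣ // MRNonwitness n m k x} ≤ Nat.card f.ker * 2 := by
    have hx₀' : f x₀ = -1 := hx₀
    let g : f.ker × Bool → (ZMod n)ˣ := fun t ↦ t.1 * if t.2 then x₀ else 1
    have hsurj : {x : (ZMod n)ˣ | MRNonwitness n m k x} ⊆ Set.range g := by
      intro x hx
      rcases hval x hx with h | h
      · exact ⟨(⟨x, h⟩, false), by simp [g]⟩
      · refine ⟨(⟨x * x₀⁻¹, ?_⟩, true), by simp [g]⟩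
        rw [MonoidHom.mem_ker, map_mul, map_inv, h, hx₀', mul_inv_cancel]
    calc Nat.card {x : (ZMod n)ˣ // MRNonwitness n m k x}
        ≤ Nat.card (Set.range g) := Nat.card_mono (Set.toFinite _) hsurj
      _ ≤ Nat.card (f.ker × Bool) := Finite.card_range_le g
      _ = Nat.card f.ker * 2 := by rw [Nat.card_prod, Nat.card_eq_fintype_card (α := Bool),
          Fintype.card_bool]
  have hrange := two_pow_le_card_range_pow (by omega) hodd hx₀
  calc Nat.card {x : (ZMod n)ˣ // MRNonwitness n m k x} * 2 ^ n.primeFactors.card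
      ≤ Nat.card f.ker * 2 * Nat.card f.range := Nat.mul_le_mul hle hrange
    _ = 2 * (Nat.card f.ker * Nat.card f.range) := by ring
    _ = 2 * Nat.card (ZMod n)ˣ := by
      rw [← Subgroup.index_ker, Subgroup.card_mul_index]

theorem exists_prime_le_pow_card_primeFactors {n : ℕ} (hn : 1 < n) :
    ∃ p, p.Prime ∧ p ∣ n ∧ n ≤ (p ^ n.factorization p) ^ n.primeFactors.card := by
  obtain ⟨p, hp, hmax⟩ := Finset.exists_max_image n.primeFactors (fun p ↦ p ^ n.factorization p)
    (Nat.nonempty_primeFactors.2 hn)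
  refine ⟨p, Nat.prime_of_mem_primeFactors hp, Nat.dvd_of_mem_primeFactors hp, ?_⟩
  conv_lhs => rw [← Nat.prod_factorization_pow_eq_self (show n ≠ 0 by omega)]
  rw [Finsupp.prod, Nat.support_factorization]
  exact Finset.prod_le_pow_card _ _ _ hmax

end

/-- Let `n` be a positive integer, not a prime power, with no prime divisor smaller
than `1000`. Let `r, d` be positive integers with `d ≥ 16` and `r·d ≤ 5.72·log n`,
and let `S` be a cyclic extension of `ℤ/nℤ` of dimension `d` with generator `σ`.
Then the density of bad witnesses for the product of `r` Miller–Rabin tests and one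
Galois test of dimension `d` is at most `2^(-0.18·r·d)`. -/
theorem stmt_3 (n : ℕ) (hn : 0 < n) (hnpp : ¬ IsPrimePow n)
    (hprimes : ∀ q : ℕ, q.Prime → q ∣ n → 1000 ≤ q)
    (r d : ℕ) (hr : 0 < r) (hd : 16 ≤ d)
    (hrd : (r : ℝ) * d ≤ 5.72 * Real.log n)
    (S : Type*) [CommRing S] [Fintype S] [Algebra (ZMod n) S]
    (hfaithful : Function.Injective (algebraMap (ZMod n) S))
    (σ : S ≃ₐ[ZMod n] S) (hord : orderOf σ = d)
    (hfix : ∀ x : S, σ x = x ↔ x ∈ Set.range (algebraMap (ZMod n) S))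
    (hunram : ∀ M : Ideal S, M.IsMaximal → ∀ i : ℕ, 0 < i → i < d →
      ∃ x : S, (σ ^ i) x - x ∉ M)
    (m k : ℕ) (hm : Odd m) (hmk : n - 1 = m * 2 ^ k) :
    (Nat.card {w : (Fin r → (ZMod n)ˣ) × Sˣ //
        (∀ i : Fin r, MRNonwitness n m k (w.1 i)) ∧ σ (w.2 : S) = (w.2 : S) ^ n} : ℝ) /
      ((Nat.card (ZMod n)ˣ : ℝ) ^ r * (Nat.card Sˣ : ℝ)) ≤
      (2 : ℝ) ^ (-(0.18 : ℝ) * r * d) := by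
  have : NeZero n := ⟨hn.ne'⟩
  have hrd0 : (0 : ℝ) < r * d := by positivity
  have hn1 : 1 < n := by
    by_contra h
    obtain rfl : n = 1 := by omega
    norm_num at hrd
    linarith
  have hodd : Odd n := by
    rw [← Nat.not_even_iff_odd, even_iff_two_dvd]
    intro h
    have := hprimes 2 Nat.prime_two h
    omega
  have hcard : Nat.card {w : (Fin r → (ZMod n)ˣ) × Sˣ //
      (∀ i : Fin r, MRNonwitness n m k (w.1 i)) ∧ σ (w.2 : S) = (w.2 : S) ^ n} =
      Nat.card {x : (ZMod n)ˣ // MRNonwitness n m k x} ^ r * Nat.card (galoisNonwitnesses σ) := by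
    have e : {w : (Fin r → (ZMod n)ˣ) × Sˣ //
        (∀ i : Fin r, MRNonwitness n m k (w.1 i)) ∧ σ (w.2 : S) = (w.2 : S) ^ n} ≃
        (Fin r → {x : (ZMod n)ˣ // MRNonwitness n m k x}) × galoisNonwitnesses σ :=
      { toFun := fun w ↦ (fun i ↦ ⟨w.1.1 i, w.2.1 i⟩, ⟨w.1.2, mem_galoisNonwitnesses.2 w.2.2⟩)
        invFun := fun w ↦ ⟨(fun i ↦ (w.1 i).1, w.2.1), fun i ↦ (w.1 i).2,
          mem_galoisNonwitnesses.1 w.2.2⟩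
        left_inv := fun _ ↦ rfl
        right_inv := fun _ ↦ rfl }
    rw [Nat.card_congr e, Nat.card_prod, Nat.card_fun, Nat.card_fin]
  have hB := card_mrNonwitness_mul_le hn1 hodd hm hmk
  have hBφ : Nat.card {x : (ZMod n)ˣ // MRNonwitness n m k x} ≤ Nat.card (ZMod n)ˣ :=
    Nat.card_le_card_of_injective _ Subtype.val_injective
  have hgs : Nat.card (galoisNonwitnesses σ) ≤ Nat.card Sˣ := Subgroup.card_le_card_group _
  obtain ⟨p, hp, hpn, hnp⟩ := exists_prime_le_pow_card_primeFactors hn1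
  have hG := card_galoisNonwitnesses_pow_le (p := p) (a := n.factorization p)
    (E := n / p ^ n.factorization p)
    (by
      rintro v rfl
      rcases Nat.eq_zero_or_pos v with rfl | hv
      · simp at hn1
      · exact hnpp (hp.isPrimePow.pow hv.ne'))
    (by omega) (by rw [← hord, pow_orderOf_eq_one]) hfix hfaithful hunram hp (hprimes p hp hpn)
    (Nat.ordProj_mul_ordCompl_eq_self n p).symm (hp.factorization_pos_of_dvd hn.ne' hpn)
    (Nat.Coprime.pow_left _ (Nat.coprime_ordCompl hp hn.ne'))
  have hφ0 : 0 < Nat.card (ZMod n)ˣ := Nat.card_pos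
  have hs0 : 0 < Nat.card Sˣ := Nat.card_pos
  have hg0 : 0 < Nat.card (galoisNonwitnesses σ) := Nat.card_pos
  have hq0 : 0 < p ^ n.factorization p := pow_pos hp.pos _
  rw [hcard]
  generalize Nat.card {x : (ZMod n)ˣ // MRNonwitness n m k x} = B at *
  generalize Nat.card (ZMod n)ˣ = φ at *
  generalize Nat.card Sˣ = s at *
  generalize Nat.card (galoisNonwitnesses σ) = g at *
  generalize p ^ n.factorization p = q at *
  generalize n.primeFactors.card = t at *
  clear hcard hfix hfaithful hunram hord
  push_cast
  rw [mul_div_mul_comm, ← div_pow]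
  have hφ0' : (0 : ℝ) < φ := by exact_mod_cast hφ0
  have hs0' : (0 : ℝ) < s := by exact_mod_cast hs0
  have hg0' : (0 : ℝ) < g := by exact_mod_cast hg0
  have hn0' : (0 : ℝ) < n := by exact_mod_cast hn
  have hq0' : (0 : ℝ) < q := by exact_mod_cast hq0
  have hBφ' : (B : ℝ) / φ ≤ 1 := div_le_one_of_le₀ (by exact_mod_cast hBφ) hφ0'.le
  have hgs' : (g : ℝ) / s ≤ 1 := div_le_one_of_le₀ (by exact_mod_cast hgs) hs0'.le
  rcases le_or_gt (1 + 0.18 * (d : ℝ)) t with ht | ht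
  · have hb : (B : ℝ) / φ ≤ 2 ^ (-(0.18 : ℝ) * d) := by
      have hB' : (B : ℝ) * 2 ^ t ≤ 2 * φ := by exact_mod_cast hB
      calc (B : ℝ) / φ ≤ 2 / 2 ^ t := by
            rw [div_le_div_iff₀ hφ0' (by positivity)]
            exact hB'
        _ = 2 ^ (1 - (t : ℝ)) := by
            rw [Real.rpow_sub two_pos, Real.rpow_one, Real.rpow_natCast]
        _ ≤ 2 ^ (-(0.18 : ℝ) * d) :=
            Real.rpow_le_rpow_of_exponent_le one_le_two (by linarith)
    calc ((B : ℝ) / φ) ^ r * (g / s) ≤ (2 ^ (-(0.18 : ℝ) * d)) ^ r * 1 := by gcongr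
      _ = 2 ^ (-(0.18 : ℝ) * r * d) := by
          rw [mul_one, ← Real.rpow_natCast, ← Real.rpow_mul two_pos.le]
          ring_nf
  · have hL : Real.log n ≤ t * Real.log q := by
      rw [← Real.log_pow]
      exact Real.log_le_log hn0' (by exact_mod_cast hnp)
    have hlog : 10 * Real.log g + 4 * d * Real.log q ≤ 10 * Real.log s + 5 * Real.log n := by
      have hG' : (g : ℝ) ^ 10 * (q : ℝ) ^ (4 * d) ≤ (s : ℝ) ^ 10 * (n : ℝ) ^ 5 := by
        exact_mod_cast hG
      have := Real.log_le_log (by positivity) hG'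
      rw [Real.log_mul (by positivity) (by positivity),
        Real.log_mul (by positivity) (by positivity), Real.log_pow, Real.log_pow, Real.log_pow,
        Real.log_pow] at this
      push_cast at this
      exact this
    have hq1 : 0 ≤ Real.log q := Real.log_natCast_nonneg q
    have hd' : (16 : ℝ) ≤ d := by exact_mod_cast hd
    have h1 : 16 * Real.log n ≤ 3.88 * (d * Real.log q) := by
      have := mul_le_mul_of_nonneg_right (show 16 * (t : ℝ) ≤ 3.88 * d by linarith) hq1
      linarith
    have hn2 : 0 ≤ Real.log n := Real.log_natCast_nonneg n
    have h2 : r * d * Real.log 2 ≤ 4 * Real.log n := by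
      have := mul_le_mul hrd Real.log_two_lt_d9.le (Real.log_pos one_lt_two).le (by positivity)
      linarith
    have h3 : (g : ℝ) / s ≤ 2 ^ (-(0.18 : ℝ) * r * d) := by
      rw [← Real.log_le_log_iff (by positivity) (by positivity), Real.log_rpow two_pos,
        Real.log_div hg0'.ne' hs0'.ne']
      linarith
    calc ((B : ℝ) / φ) ^ r * (g / s) ≤ 1 * (g / s) := by
          gcongr
          exact pow_le_one₀ (by positivity) hBφ'
      _ ≤ _ := by rwa [one_mul]
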